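/- arXiv:2012.11505 — 10 statements merged into one kernel-verified Lean document; each statement's English description precedes it below -/
import Mathlib

section
/- For any function f : ℤ≥0 → ℝ, the sum over the gaps of S of the differences f(i+m) − f(i) equals the sum over residues of the differences of f at the Apéry elements and at the residues: ∑_{i ∈ C(S)} (f(i+m) − f(i)) = ∑_{i=0}^{m−1} (f(a_i) − f(i)). -/
open Finset

/-- **Gassert–Shor formula.**  Let `S ⊆ ℕ` be a numerical semigroup (containing `0`,
closed under addition, with finite nonempty gap set `C`), let `m ∈ S`, `m ≠ 0`, and let
`a i` (for `i < m`) be the element of the Apéry set `S^(m) = {s ∈ S : s - m ∉ S}`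
congruent to `i` mod `m`.  Then for any `f : ℕ → ℝ`,
`∑_{i ∈ C(S)} (f (i+m) - f i) = ∑_{i=0}^{m-1} (f (a i) - f i)`. -/
theorem gassert_shor
    (S : Set ℕ) (h0 : 0 ∈ S) (hadd : ∀ a ∈ S, ∀ b ∈ S, a + b ∈ S)
    (C : Finset ℕ) (hC : ∀ k, k ∈ C ↔ k ∉ S) (hCne : C.Nonempty)
    (m : ℕ) (hm0 : m ≠ 0) (hm : m ∈ S)
    (a : ℕ → ℕ)
    (ha : ∀ i < m, (a i ∈ S ∧ ∀ t ∈ S, t + m ≠ a i) ∧ a i % m = i)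
    (f : ℕ → ℝ) :
    ∑ i ∈ C, (f (i + m) - f i) = ∑ i ∈ Finset.range m, (f (a i) - f i) := by
  have hmul : ∀ k ∈ S, ∀ j : ℕ, k + m * j ∈ S := by
    intro k hk j
    induction j with
    | zero => simpa using hk
    | succ j ih =>
      have := hadd _ ih _ hm
      rwa [add_assoc, ← Nat.mul_succ] at this
  have hmpos : 0 < m := Nat.pos_of_ne_zero hm0
  have key : ∀ i < m, ∀ j : ℕ, i + m * j ∈ C ↔ j < a i / m := by
    intro i hi j
    obtain ⟨⟨h1, h2⟩, h3⟩ := ha i hi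
    have h4 := Nat.mod_add_div (a i) m
    rw [h3] at h4
    rw [hC]
    constructor
    · intro h
      by_contra hlt
      push Not at hlt
      obtain ⟨d, hd⟩ := Nat.exists_eq_add_of_le hlt
      apply h
      have := hmul _ h1 d
      rw [← h4, add_assoc, ← Nat.mul_add, ← hd] at this
      exact this
    · intro h hS
      obtain ⟨d, hd⟩ := Nat.exists_eq_add_of_lt h
      apply h2 _ (hmul _ hS d)
      rw [← h4, hd]
      ring
  have hmaps : ∀ k ∈ C, k % m ∈ Finset.range m := fun k _ =>
    Finset.mem_range.2 (Nat.mod_lt _ hmpos)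
  rw [← Finset.sum_fiberwise_of_maps_to hmaps]
  apply Finset.sum_congr rfl
  intro i hi
  have hi' := Finset.mem_range.1 hi
  have hset : C.filter (fun k => k % m = i) =
      (Finset.range (a i / m)).image (fun j => i + m * j) := by
    ext k
    simp only [Finset.mem_filter, Finset.mem_image, Finset.mem_range]
    constructor
    · rintro ⟨hk, hki⟩
      have h4 := Nat.mod_add_div k m
      rw [hki] at h4
      exact ⟨k / m, (key i hi' _).1 (by rwa [h4]), h4⟩
    · rintro ⟨j, hj, rfl⟩
      exact ⟨(key i hi' j).2 hj, by rw [Nat.add_mul_mod_self_left, Nat.mod_eq_of_lt hi']⟩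
  rw [hset, Finset.sum_image]
  · have h4 := Nat.mod_add_div (a i) m
    rw [(ha i hi').2] at h4
    have := Finset.sum_range_sub (fun j => f (i + m * j)) (a i / m)
    simp only [h4, Nat.mul_zero, Nat.add_zero] at this
    rw [← this]
    apply Finset.sum_congr rfl
    intro j _
    rw [Nat.mul_succ, add_assoc]
  · intro x _ y _ hxy
    exact Nat.eq_of_mul_eq_mul_left hmpos (Nat.add_left_cancel hxy)
end

section
/- Let F : ℝ^p → ℝ be a symmetric function (invariant under all permutations of its p arguments) and f : ℤ≥0 → ℝ any function, with 1 ≤ p ≤ m. Then ∑_{i=1}^n ( ∑_{J ⊆ T_i, |J| = p−1} F(f{J}, f(c_i + m)) − ∑_{J ⊆ T_i, |J| = p−1} F(f{J}, f(c_i)) ) = ∑_{I ⊆ S^(m), |I| = p} F(f{I}) − ∑_{I ⊆ I_m, |I| = p} F(f{I}). -/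
open Finset

/-- `SetSi c i` is the numerical semigroup `S_i := ℕ \ {c 1, …, c i}` obtained by
removing the first `i` gaps `c 1 < c 2 < … < c i` from `ℕ`. -/
def SetSi (c : ℕ → ℕ) (i : ℕ) : Set ℕ := {s | ∀ j ∈ Finset.Icc 1 i, s ≠ c j}

/-- `A` is the Apéry set of `T ⊆ ℕ` with respect to `m`: the elements `s ∈ T` with
`s - m ∉ T`, i.e. such that no `t ∈ T` satisfies `t + m = s`. -/
def IsApery (T : Set ℕ) (m : ℕ) (A : Finset ℕ) : Prop :=
  ∀ s, s ∈ A ↔ s ∈ T ∧ ∀ t ∈ T, t + m ≠ s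

theorem sum_powersetCard_erase_aux (A : Finset ℕ) (x : ℕ) (hx : x ∈ A) (q : ℕ)
    (F : Multiset ℝ → ℝ) (f : ℕ → ℝ) :
    ∑ I ∈ A.powersetCard (q + 1), F (I.val.map f)
      = ∑ I ∈ (A.erase x).powersetCard (q + 1), F (I.val.map f)
        + ∑ J ∈ (A.erase x).powersetCard q, F (f x ::ₘ J.val.map f) := by
  have hnot : ∀ J ∈ (A.erase x).powersetCard q, x ∉ J := by
    intro J hJ hxJ
    exact Finset.notMem_erase x A ((Finset.mem_powersetCard.1 hJ).1 hxJ)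
  conv_lhs => rw [← Finset.insert_erase hx]
  rw [Finset.powersetCard_succ_insert (Finset.notMem_erase x A), Finset.sum_union, Finset.sum_image]
  · congr 1
    refine Finset.sum_congr rfl fun J hJ => ?_
    rw [Finset.insert_val_of_notMem (hnot J hJ), Multiset.map_cons]
  · intro J hJ K hK h
    rw [← Finset.erase_insert (hnot J hJ), ← Finset.erase_insert (hnot K hK), h]
  · rw [Finset.disjoint_left]
    intro J hJ hJ'
    obtain ⟨K, _, rfl⟩ := Finset.mem_image.1 hJ'
    exact Finset.notMem_erase x A ((Finset.mem_powersetCard.1 hJ).1 (Finset.mem_insert_self x K))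

theorem setSi_succ_aux (c : ℕ → ℕ) (k s : ℕ) :
    s ∈ SetSi c (k + 1) ↔ s ∈ SetSi c k ∧ s ≠ c (k + 1) := by
  simp only [SetSi, Set.mem_setOf_eq, Finset.mem_Icc]
  constructor
  · intro h
    exact ⟨fun j hj => h j ⟨hj.1, by omega⟩, h (k + 1) ⟨by omega, le_rfl⟩⟩
  · rintro ⟨h1, h2⟩ j hj
    rcases Nat.lt_or_ge k j with h | h
    · obtain rfl : j = k + 1 := by omega
      exact h2
    · exact h1 j ⟨hj.1, h⟩

/-- **Difference relation for a symmetric function of the Apéry values.**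
`S = S_n ⊂ … ⊂ S_0 = ℕ` is the canonical path, `Ap i = S_i^(m)`,
`T_i = S_i^(m) \ {c_i + m}`.  A symmetric function `F` of `p` real arguments is
encoded as a function of the multiset of its arguments.  Then
`∑_{i=1}^n ( ∑_{J ⊆ T_i, |J|=p-1} F(f{J}, f(c_i+m)) − ∑_{J ⊆ T_i, |J|=p-1} F(f{J}, f(c_i)) )
 = ∑_{I ⊆ S^(m), |I|=p} F(f{I}) − ∑_{I ⊆ I_m, |I|=p} F(f{I})`. -/
theorem symmetric_difference_relation
    (n : ℕ) (hn : 0 < n)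
    (c : ℕ → ℕ) (hc : StrictMonoOn c (Set.Icc 1 n))
    (hzero : (0 : ℕ) ∈ SetSi c n)
    (hadd : ∀ a ∈ SetSi c n, ∀ b ∈ SetSi c n, a + b ∈ SetSi c n)
    (m : ℕ) (hm0 : m ≠ 0) (hm : m ∈ SetSi c n)
    (Ap : ℕ → Finset ℕ) (hAp : ∀ i ≤ n, IsApery (SetSi c i) m (Ap i))
    (F : Multiset ℝ → ℝ) (f : ℕ → ℝ)
    (p : ℕ) (hp : 1 ≤ p) (hpm : p ≤ m) :
    ∑ i ∈ Finset.Icc 1 n,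
        ((∑ J ∈ ((Ap i).erase (c i + m)).powersetCard (p - 1),
            F (f (c i + m) ::ₘ J.val.map f))
         - ∑ J ∈ ((Ap i).erase (c i + m)).powersetCard (p - 1),
            F (f (c i) ::ₘ J.val.map f))
      = ∑ I ∈ (Ap n).powersetCard p, F (I.val.map f)
        - ∑ I ∈ (Finset.range m).powersetCard p, F (I.val.map f) := by
  obtain ⟨q, rfl⟩ : ∃ q, p = q + 1 := ⟨p - 1, by omega⟩
  simp only [Nat.add_sub_cancel]
  have h0 : Ap 0 = Finset.range m := by
    ext s
    rw [hAp 0 (Nat.zero_le _) s]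
    simp only [SetSi, Set.mem_setOf_eq, Finset.mem_Icc, Finset.mem_range]
    constructor
    · rintro ⟨_, h⟩
      by_contra hs
      exact h (s - m) (fun j hj => by omega) (by omega)
    · intro h
      exact ⟨fun j hj => by omega, fun t _ => by omega⟩
  have key : ∀ k ≤ n, ∑ i ∈ Finset.Icc 1 k,
        ((∑ J ∈ ((Ap i).erase (c i + m)).powersetCard q,
            F (f (c i + m) ::ₘ J.val.map f))
         - ∑ J ∈ ((Ap i).erase (c i + m)).powersetCard q,
            F (f (c i) ::ₘ J.val.map f))
      = ∑ I ∈ (Ap k).powersetCard (q + 1), F (I.val.map f)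
        - ∑ I ∈ (Finset.range m).powersetCard (q + 1), F (I.val.map f) := by
    intro k
    induction k with
    | zero => intro _; simp [h0]
    | succ k ih =>
      intro hk
      rw [Finset.sum_Icc_succ_top (by omega), ih (by omega)]
      have hck : c (k + 1) ∈ SetSi c k := by
        intro j hj
        rw [Finset.mem_Icc] at hj
        exact (hc ⟨hj.1, by omega⟩ ⟨by omega, hk⟩ (by omega : j < k + 1)).ne'
      have hm1 : c (k + 1) ∈ Ap k := by
        rw [hAp k (by omega)]
        refine ⟨hck, fun t ht he => ?_⟩
        have htn : t ∈ SetSi c n := by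
          intro j hj hjt
          rw [Finset.mem_Icc] at hj
          rcases Nat.lt_or_ge k j with h | h
          · have := hc.monotoneOn (a := k + 1) (b := j) ⟨by omega, hk⟩ ⟨hj.1, hj.2⟩ (by omega)
            omega
          · exact ht j (Finset.mem_Icc.2 ⟨hj.1, h⟩) hjt
        exact hadd t htn m hm (k + 1) (Finset.mem_Icc.2 ⟨by omega, hk⟩) he
      have hm2 : c (k + 1) + m ∈ Ap (k + 1) := by
        rw [hAp (k + 1) hk]
        refine ⟨fun j hj => ?_, fun t ht he => ?_⟩
        · rw [Finset.mem_Icc] at hj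
          have := hc.monotoneOn (a := j) (b := k + 1) ⟨hj.1, by omega⟩ ⟨by omega, hk⟩ hj.2
          omega
        · exact ((setSi_succ_aux c k t).1 ht).2 (by omega)
      have he : (Ap (k + 1)).erase (c (k + 1) + m) = (Ap k).erase (c (k + 1)) := by
        ext s
        rw [Finset.mem_erase, Finset.mem_erase, hAp (k + 1) hk, hAp k (by omega), setSi_succ_aux]
        constructor
        · rintro ⟨h1, ⟨h2, h3⟩, h4⟩
          refine ⟨h3, h2, fun t ht hts => ?_⟩
          by_cases htc : t = c (k + 1)
          · subst htc; exact h1 hts.symm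
          · exact h4 t ((setSi_succ_aux c k t).2 ⟨ht, htc⟩) hts
        · rintro ⟨h3, h2, h4⟩
          exact ⟨fun h => h4 _ hck h.symm, ⟨h2, h3⟩,
            fun t ht => h4 t ((setSi_succ_aux c k t).1 ht).1⟩
      rw [sum_powersetCard_erase_aux (Ap (k + 1)) _ hm2 q F f,
        sum_powersetCard_erase_aux (Ap k) _ hm1 q F f, he]
      ring
  exact key n le_rfl
end

section
/- (Proposition 1, case p = m) For any f : ℤ≥0 → ℝ and any z ∈ ℝ: ∑_{i=1}^n (f(c_i + m) − f(c_i)) · ∏_{a ∈ T_i} (z + f(a)) = ∏_{a ∈ S^(m)} (z + f(a)) − ∏_{a ∈ I_m} (z + f(a)). -/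
open Finset

/-- **Proposition 1, case `p = m`.**  With `S = S_n ⊂ … ⊂ S_0 = ℕ` the canonical path,
`Ap i = S_i^(m)` and `T_i = S_i^(m) \ {c_i + m}`, for any `f : ℕ → ℝ` and `z ∈ ℝ`:
`∑_{i=1}^n (f(c_i+m) − f(c_i)) ∏_{a ∈ T_i} (z + f a)
 = ∏_{a ∈ S^(m)} (z + f a) − ∏_{a ∈ I_m} (z + f a)`. -/
theorem prop1_case_p_eq_m
    (n : ℕ) (hn : 0 < n)
    (c : ℕ → ℕ) (hc : StrictMonoOn c (Set.Icc 1 n))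
    (hzero : (0 : ℕ) ∈ SetSi c n)
    (hadd : ∀ a ∈ SetSi c n, ∀ b ∈ SetSi c n, a + b ∈ SetSi c n)
    (m : ℕ) (hm0 : m ≠ 0) (hm : m ∈ SetSi c n)
    (Ap : ℕ → Finset ℕ) (hAp : ∀ i ≤ n, IsApery (SetSi c i) m (Ap i))
    (f : ℕ → ℝ) (z : ℝ) :
    ∑ i ∈ Finset.Icc 1 n,
        (f (c i + m) - f (c i)) * ∏ a ∈ (Ap i).erase (c i + m), (z + f a)
      = ∏ a ∈ Ap n, (z + f a) - ∏ a ∈ Finset.range m, (z + f a) := by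
  have key : ∀ k, k ≤ n → ∑ i ∈ Finset.Icc 1 k,
        (f (c i + m) - f (c i)) * ∏ a ∈ (Ap i).erase (c i + m), (z + f a)
      = ∏ a ∈ Ap k, (z + f a) - ∏ a ∈ Finset.range m, (z + f a) := by
    intro k
    induction k with
    | zero =>
      intro _
      have h0 : Ap 0 = Finset.range m := by
        ext s
        rw [hAp 0 (Nat.zero_le _) s, Finset.mem_range]
        constructor
        · rintro ⟨_, h⟩
          by_contra hs
          exact h (s - m) (by intro j hj; simp at hj) (by omega)
        · intro hs
          exact ⟨by intro j hj; simp at hj, fun t _ => by omega⟩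
      simp [h0]
    | succ k ih =>
      intro hk
      rw [Finset.sum_Icc_succ_top (by omega), ih (by omega)]
      have hS : ∀ s, s ∈ SetSi c (k+1) ↔ s ∈ SetSi c k ∧ s ≠ c (k+1) := by
        intro s
        constructor
        · intro h
          refine ⟨fun j hj => h j ?_, h (k+1) (by simp)⟩
          rw [Finset.mem_Icc] at hj ⊢; omega
        · rintro ⟨h, h'⟩ j hj
          rw [Finset.mem_Icc] at hj
          rcases Nat.lt_or_ge k j with hlt | hge
          · have : j = k + 1 := by omega
            rw [this]; exact h'
          · exact h j (Finset.mem_Icc.2 ⟨hj.1, hge⟩)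
      have hmono : ∀ i j, 1 ≤ i → i < j → j ≤ n → c i < c j := fun i j h1 h2 h3 =>
        hc ⟨h1, by omega⟩ ⟨by omega, h3⟩ h2
      have hbig : ∀ s, c (k+1) ≤ s → s ∈ SetSi c k := by
        intro s hs j hj
        rw [Finset.mem_Icc] at hj
        have := hmono j (k+1) hj.1 (by omega) hk
        omega
      have hno : ∀ t ∈ SetSi c k, t + m ≠ c (k+1) := by
        intro t ht he
        have htn : t ∈ SetSi c n := by
          intro j hj
          rw [Finset.mem_Icc] at hj
          rcases Nat.lt_or_ge k j with hlt | hge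
          · rcases Nat.eq_or_lt_of_le (Nat.succ_le_of_lt hlt) with h | h
            · rw [← h]; simp only [Nat.succ_eq_add_one]; omega
            · have := hmono (k+1) j (by omega) h hj.2
              omega
          · exact ht j (Finset.mem_Icc.2 ⟨hj.1, hge⟩)
        exact hadd t htn m hm (k+1) (Finset.mem_Icc.2 ⟨by omega, hk⟩) he
      have h1 : c (k+1) ∈ Ap k := (hAp k (by omega) _).2 ⟨hbig _ le_rfl, hno⟩
      have h2 : c (k+1) + m ∈ Ap (k+1) := by
        refine (hAp (k+1) hk _).2 ⟨(hS _).2 ⟨hbig _ (by omega), by omega⟩, ?_⟩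
        intro t ht
        have := ((hS t).1 ht).2
        omega
      have h3 : (Ap (k+1)).erase (c (k+1) + m) = (Ap k).erase (c (k+1)) := by
        ext s
        rw [Finset.mem_erase, Finset.mem_erase, hAp k (by omega) s, hAp (k+1) hk s, hS]
        constructor
        · rintro ⟨a, ⟨b, b'⟩, d⟩
          refine ⟨b', b, fun t ht he => ?_⟩
          by_cases htc : t = c (k+1)
          · subst htc; exact a he.symm
          · exact d t ((hS t).2 ⟨ht, htc⟩) he
        · rintro ⟨a, b, d⟩
          exact ⟨fun he => d _ (hbig _ le_rfl) he.symm, ⟨b, a⟩,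
            fun t ht => d t ((hS t).1 ht).1⟩
      rw [← Finset.mul_prod_erase (Ap (k+1)) _ h2, ← Finset.mul_prod_erase (Ap k) _ h1, h3]
      ring
  exact key n le_rfl
end

section
/- (Proposition 2) Let f : ℤ≥0 → ℝ and let z ∈ ℝ satisfy z ≠ f(j) for every j ∈ {0, 1, …, F(S) + m}. Then for any 1 ≤ p ≤ m: ∑_{i=1}^n (f(c_i + m) − f(c_i)) / ((z − f(c_i))·(z − f(c_i + m))) · ( ∑_{J ⊆ T_i, |J| = p−1} ∏_{a ∈ J} (z − f(a))^{−1} ) = ∑_{I ⊆ S^(m), |I| = p} ∏_{a ∈ I} (z − f(a))^{−1} − ∑_{I ⊆ I_m, |I| = p} ∏_{a ∈ I} (z − f(a))^{−1}. -/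
open Finset

theorem esum_insert (w : ℕ → ℝ) (T : Finset ℕ) (a : ℕ) (ha : a ∉ T) (q : ℕ) :
    ∑ I ∈ (insert a T).powersetCard (q + 1), ∏ x ∈ I, w x
      = ∑ I ∈ T.powersetCard (q + 1), ∏ x ∈ I, w x
        + w a * ∑ I ∈ T.powersetCard q, ∏ x ∈ I, w x := by
  have hno : ∀ I ∈ T.powersetCard q, a ∉ I := fun I hI h =>
    ha ((Finset.mem_powersetCard.1 hI).1 h)
  rw [Finset.powersetCard_succ_insert ha, Finset.sum_union, Finset.sum_image, Finset.mul_sum]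
  · congr 1
    exact Finset.sum_congr rfl fun I hI => Finset.prod_insert (hno I hI)
  · intro I hI J hJ h
    have h' : (insert a I).erase a = (insert a J).erase a := by
      rw [h]
    rwa [Finset.erase_insert (hno I hI), Finset.erase_insert (hno J hJ)] at h'
  · rw [Finset.disjoint_left]
    intro I hI hI'
    obtain ⟨J, _, rfl⟩ := Finset.mem_image.1 hI'
    exact ha ((Finset.mem_powersetCard.1 hI).1 (Finset.mem_insert_self a J))

/-- **Proposition 2.**  With `S = S_n ⊂ … ⊂ S_0 = ℕ` the canonical path, `Ap i = S_i^(m)`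
and `T_i = S_i^(m) \ {c_i + m}`, let `f : ℕ → ℝ` and let `z ∈ ℝ` avoid all values `f j`
for `j ≤ F(S) + m = c n + m`.  Then for `1 ≤ p ≤ m`:
`∑_{i=1}^n (f(c_i+m) − f(c_i))/((z − f(c_i))(z − f(c_i+m)))
      ∑_{J ⊆ T_i, |J|=p-1} ∏_{a ∈ J} (z − f a)⁻¹
 = ∑_{I ⊆ S^(m), |I|=p} ∏_{a ∈ I} (z − f a)⁻¹ − ∑_{I ⊆ I_m, |I|=p} ∏_{a ∈ I} (z − f a)⁻¹`. -/
theorem prop2_generalized_gassert_shor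
    (n : ℕ) (hn : 0 < n)
    (c : ℕ → ℕ) (hc : StrictMonoOn c (Set.Icc 1 n))
    (hzero : (0 : ℕ) ∈ SetSi c n)
    (hadd : ∀ a ∈ SetSi c n, ∀ b ∈ SetSi c n, a + b ∈ SetSi c n)
    (m : ℕ) (hm0 : m ≠ 0) (hm : m ∈ SetSi c n)
    (Ap : ℕ → Finset ℕ) (hAp : ∀ i ≤ n, IsApery (SetSi c i) m (Ap i))
    (f : ℕ → ℝ) (z : ℝ) (hz : ∀ j ≤ c n + m, z ≠ f j)
    (p : ℕ) (hp : 1 ≤ p) (hpm : p ≤ m) :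
    ∑ i ∈ Finset.Icc 1 n,
        (f (c i + m) - f (c i)) / ((z - f (c i)) * (z - f (c i + m))) *
          ∑ J ∈ ((Ap i).erase (c i + m)).powersetCard (p - 1),
            ∏ a ∈ J, (z - f a)⁻¹
      = ∑ I ∈ (Ap n).powersetCard p, ∏ a ∈ I, (z - f a)⁻¹
        - ∑ I ∈ (Finset.range m).powersetCard p, ∏ a ∈ I, (z - f a)⁻¹ := by
  obtain ⟨q, rfl⟩ : ∃ q, p = q + 1 := ⟨p - 1, by omega⟩
  have hmono : ∀ i j, 1 ≤ i → i ≤ j → j ≤ n → c i ≤ c j := fun i j h1 h2 h3 =>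
    hc.monotoneOn ⟨h1, by omega⟩ ⟨by omega, h3⟩ h2
  have hlt : ∀ i j, 1 ≤ i → i < j → j ≤ n → c i < c j := fun i j h1 h2 h3 =>
    hc ⟨h1, by omega⟩ ⟨by omega, h3⟩ h2
  have hS : ∀ k s, s ∈ SetSi c (k + 1) ↔ s ∈ SetSi c k ∧ s ≠ c (k + 1) := by
    intro k s
    simp only [SetSi, Set.mem_setOf_eq, Finset.mem_Icc]
    constructor
    · intro h
      exact ⟨fun j hj => h j ⟨hj.1, by omega⟩, h _ ⟨by omega, le_rfl⟩⟩
    · rintro ⟨h1, h2⟩ j hj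
      by_cases e : j = k + 1
      · rw [e]; exact h2
      · exact h1 j ⟨hj.1, by omega⟩
  have hcS : ∀ k, k + 1 ≤ n → ∀ t, c (k + 1) ≤ t → t ∈ SetSi c k := by
    intro k hk t ht j hj
    have hj := Finset.mem_Icc.1 hj
    have := hlt j (k + 1) hj.1 (by omega) hk
    omega
  have hkey : ∀ k, k + 1 ≤ n → ∀ t ∈ SetSi c k, t + m ≠ c (k + 1) := by
    intro k hk t ht e
    have htn : t ∈ SetSi c n := by
      intro j hj
      by_cases h : j ≤ k
      · exact ht j (Finset.mem_Icc.2 ⟨(Finset.mem_Icc.1 hj).1, h⟩)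
      · have := hmono (k + 1) j (by omega) (by omega) (Finset.mem_Icc.1 hj).2
        omega
    exact hadd t htn m hm (k + 1) (Finset.mem_Icc.2 ⟨by omega, hk⟩) e
  have main : ∀ k ≤ n, ∑ i ∈ Finset.Icc 1 k,
        (f (c i + m) - f (c i)) / ((z - f (c i)) * (z - f (c i + m))) *
          ∑ J ∈ ((Ap i).erase (c i + m)).powersetCard q, ∏ a ∈ J, (z - f a)⁻¹
      = ∑ I ∈ (Ap k).powersetCard (q + 1), ∏ a ∈ I, (z - f a)⁻¹
        - ∑ I ∈ (Finset.range m).powersetCard (q + 1), ∏ a ∈ I, (z - f a)⁻¹ := by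
    intro k
    induction k with
    | zero =>
      intro h0
      have : Ap 0 = Finset.range m := by
        ext s
        rw [hAp 0 h0 s, Finset.mem_range]
        have hall : ∀ t, t ∈ SetSi c 0 := by
          intro t j hj
          simp at hj
        constructor
        · rintro ⟨_, h⟩
          by_contra hs
          exact h (s - m) (hall _) (by omega)
        · intro h
          exact ⟨hall _, fun t _ => by omega⟩
      rw [this]; simp
    | succ k ih =>
      intro hk
      rw [Finset.sum_Icc_succ_top (by omega), ih (by omega)]
      set T := (Ap (k + 1)).erase (c (k + 1) + m) with hT
      have hmem : c (k + 1) + m ∈ Ap (k + 1) := by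
        rw [hAp (k + 1) hk, hS]
        refine ⟨⟨hcS k hk _ (by omega), by omega⟩, fun t ht e => ?_⟩
        exact ((hS k t).1 ht).2 (by omega)
      have h1 : Ap (k + 1) = insert (c (k + 1) + m) T := (Finset.insert_erase hmem).symm
      have hnot : c (k + 1) ∉ T := by
        intro h
        have := (hAp (k + 1) hk _).1 (Finset.mem_of_mem_erase h)
        exact ((hS k _).1 this.1).2 rfl
      have h2 : Ap k = insert (c (k + 1)) T := by
        ext s
        rw [Finset.mem_insert, hT, Finset.mem_erase, hAp k (by omega), hAp (k + 1) hk, hS]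
        constructor
        · rintro ⟨hs, hs'⟩
          by_cases e : s = c (k + 1)
          · exact Or.inl e
          · refine Or.inr ⟨fun e' => ?_, ⟨hs, e⟩, fun t ht => hs' t ((hS k t).1 ht).1⟩
            exact hs' _ (hcS k hk _ le_rfl) e'.symm
        · rintro (e | ⟨hne, ⟨hs, _⟩, h⟩)
          · subst e
            exact ⟨hcS k hk _ le_rfl, hkey k hk⟩
          · refine ⟨hs, fun t ht e => ?_⟩
            by_cases e' : t = c (k + 1)
            · exact hne (by omega)
            · exact h t ((hS k t).2 ⟨ht, e'⟩) e
      have hle := hmono (k + 1) n (by omega) hk le_rfl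
      have z1 : z - f (c (k + 1)) ≠ 0 := sub_ne_zero.2 (hz _ (by omega))
      have z2 : z - f (c (k + 1) + m) ≠ 0 := sub_ne_zero.2 (hz _ (by omega))
      have hw : (f (c (k + 1) + m) - f (c (k + 1))) /
          ((z - f (c (k + 1))) * (z - f (c (k + 1) + m)))
          = (z - f (c (k + 1) + m))⁻¹ - (z - f (c (k + 1)))⁻¹ := by
        field_simp
        ring
      rw [hw, h2, h1, esum_insert (fun a => (z - f a)⁻¹) T _ hnot,
        esum_insert (fun a => (z - f a)⁻¹) T _ (Finset.notMem_erase _ _)]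
      ring
  exact main n le_rfl
end

section
/- (Proposition 2, case p = m) Let f : ℤ≥0 → ℝ and let z ∈ ℝ satisfy z ≠ f(j) for every j ∈ {0, 1, …, F(S) + m}. Then ∑_{i=1}^n (f(c_i + m) − f(c_i)) / ((z − f(c_i))·(z − f(c_i + m))) · ∏_{a ∈ T_i} (z − f(a))^{−1} = ∏_{a ∈ S^(m)} (z − f(a))^{−1} − ∏_{a ∈ I_m} (z − f(a))^{−1}. -/
open Finset

/-- **Proposition 2, case `p = m`.**  With `S = S_n ⊂ … ⊂ S_0 = ℕ` the canonical path,
`Ap i = S_i^(m)` and `T_i = S_i^(m) \ {c_i + m}`, let `f : ℕ → ℝ` and let `z ∈ ℝ` avoid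
all values `f j` for `j ≤ F(S) + m = c n + m`.  Then
`∑_{i=1}^n (f(c_i+m) − f(c_i))/((z − f(c_i))(z − f(c_i+m))) ∏_{a ∈ T_i} (z − f a)⁻¹
 = ∏_{a ∈ S^(m)} (z − f a)⁻¹ − ∏_{a ∈ I_m} (z − f a)⁻¹`. -/
theorem prop2_case_p_eq_m
    (n : ℕ) (hn : 0 < n)
    (c : ℕ → ℕ) (hc : StrictMonoOn c (Set.Icc 1 n))
    (hzero : (0 : ℕ) ∈ SetSi c n)
    (hadd : ∀ a ∈ SetSi c n, ∀ b ∈ SetSi c n, a + b ∈ SetSi c n)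
    (m : ℕ) (hm0 : m ≠ 0) (hm : m ∈ SetSi c n)
    (Ap : ℕ → Finset ℕ) (hAp : ∀ i ≤ n, IsApery (SetSi c i) m (Ap i))
    (f : ℕ → ℝ) (z : ℝ) (hz : ∀ j ≤ c n + m, z ≠ f j) :
    ∑ i ∈ Finset.Icc 1 n,
        (f (c i + m) - f (c i)) / ((z - f (c i)) * (z - f (c i + m))) *
          ∏ a ∈ (Ap i).erase (c i + m), (z - f a)⁻¹
      = ∏ a ∈ Ap n, (z - f a)⁻¹ - ∏ a ∈ Finset.range m, (z - f a)⁻¹ := by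
  have hbound : ∀ k, 1 ≤ k → k ≤ n → c k ≤ c n := fun k h1 h2 =>
    hc.monotoneOn ⟨h1, h2⟩ ⟨hn, le_refl n⟩ h2
  have key : ∀ k ≤ n, ∑ i ∈ Finset.Icc 1 k,
        (f (c i + m) - f (c i)) / ((z - f (c i)) * (z - f (c i + m))) *
          ∏ a ∈ (Ap i).erase (c i + m), (z - f a)⁻¹
      = ∏ a ∈ Ap k, (z - f a)⁻¹ - ∏ a ∈ Finset.range m, (z - f a)⁻¹ := by
    intro k
    induction k with
    | zero =>
      intro _
      have h0 : Ap 0 = Finset.range m := by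
        ext s
        rw [hAp 0 (Nat.zero_le _) s]
        simp only [SetSi, Finset.mem_Icc, Set.mem_setOf_eq, Finset.mem_range]
        constructor
        · rintro ⟨_, h⟩
          by_contra hs
          exact h (s - m) (fun j hj => by omega) (by omega)
        · intro h
          exact ⟨fun j hj => by omega, fun t _ => by omega⟩
      rw [h0]; simp
    | succ k ih =>
      intro hk
      rw [Finset.sum_Icc_succ_top (by omega), ih (by omega)]
      have hlt : ∀ j, 1 ≤ j → j ≤ k → c j < c (k+1) := fun j h1 h2 =>
        hc ⟨h1, by omega⟩ ⟨by omega, hk⟩ (by omega)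
      have hgt : ∀ j, k + 1 < j → j ≤ n → c (k+1) < c j := fun j h1 h2 =>
        hc ⟨by omega, hk⟩ ⟨by omega, h2⟩ h1
      have hS : ∀ s, s ∈ SetSi c (k+1) ↔ s ∈ SetSi c k ∧ s ≠ c (k+1) := by
        intro s
        simp only [SetSi, Finset.mem_Icc, Set.mem_setOf_eq]
        constructor
        · intro h
          exact ⟨fun j hj => h j (by omega), h _ (by omega)⟩
        · rintro ⟨h, h'⟩ j hj
          rcases Nat.lt_or_ge k j with h1 | h1
          · have : j = k + 1 := by omega
            rw [this]; exact h'
          · exact h j (by omega)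
      have hck : c (k+1) ∈ SetSi c k := by
        intro j hj
        rw [Finset.mem_Icc] at hj
        exact (hlt j hj.1 hj.2).ne'
      have hckm : c (k+1) + m ∈ SetSi c k := by
        intro j hj
        rw [Finset.mem_Icc] at hj
        have := hlt j hj.1 hj.2
        omega
      have hA := hAp (k+1) hk
      have hB := hAp k (by omega)
      have m1 : c (k+1) + m ∈ Ap (k+1) := by
        rw [hA, hS]
        refine ⟨⟨hckm, by omega⟩, fun t ht h => ?_⟩
        exact ((hS t).1 ht).2 (by omega)
      have m2 : c (k+1) ∈ Ap k := by
        rw [hB]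
        refine ⟨hck, fun t ht h => ?_⟩
        have htn : t ∈ SetSi c n := by
          intro j hj
          rw [Finset.mem_Icc] at hj
          rcases Nat.lt_or_ge k j with h1 | h1
          · rcases Nat.lt_or_ge (k+1) j with h2 | h2
            · have := hgt j h2 hj.2
              omega
            · have : j = k + 1 := by omega
              rw [this]; omega
          · exact ht j (Finset.mem_Icc.2 ⟨hj.1, h1⟩)
        exact hadd t htn m hm (k+1) (Finset.mem_Icc.2 ⟨by omega, hk⟩) h
      have hE : (Ap (k+1)).erase (c (k+1) + m) = (Ap k).erase (c (k+1)) := by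
        ext s
        rw [Finset.mem_erase, Finset.mem_erase, hA, hB, hS]
        constructor
        · rintro ⟨h1, ⟨h2, h3⟩, h4⟩
          refine ⟨h3, h2, fun t ht h => ?_⟩
          by_cases hh : t = c (k+1)
          · exact h1 (by omega)
          · exact h4 t ((hS t).2 ⟨ht, hh⟩) h
        · rintro ⟨h1, h2, h3⟩
          exact ⟨fun h => h3 _ hck h.symm, ⟨h2, h1⟩, fun t ht => h3 t ((hS t).1 ht).1⟩
      rw [← Finset.mul_prod_erase _ _ m1, ← Finset.mul_prod_erase _ _ m2, hE]
      have b := hbound (k+1) (by omega) hk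
      have z1 : z - f (c (k+1)) ≠ 0 := sub_ne_zero.2 (hz _ (by omega))
      have z2 : z - f (c (k+1) + m) ≠ 0 := sub_ne_zero.2 (hz _ (by omega))
      have e : (f (c (k+1) + m) - f (c (k+1))) / ((z - f (c (k+1))) * (z - f (c (k+1) + m)))
          = (z - f (c (k+1) + m))⁻¹ - (z - f (c (k+1)))⁻¹ := by
        rw [inv_sub_inv z2 z1, mul_comm (z - f (c (k+1)))]
        congr 1
        ring
      rw [e]
      ring
  exact key n le_rfl
end

section
/- (Proposition 3) For any f : ℤ≥0 → ℝ, any 1 ≤ p ≤ m, and any 1 ≤ k ≤ p: ∑_{i=1}^n (f(c_i + m) − f(c_i)) · ( ∑_{J ⊆ T_i, |J| = p−1} e_{k−1}(f{J}) ) = ∑_{I ⊆ S^(m), |I| = p} e_k(f{I}) − ∑_{I ⊆ I_m, |I| = p} e_k(f{I}), where e_k denotes the k-th elementary symmetric polynomial of its arguments (and e_0 = 1). -/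
open Finset

theorem esymm_cons_aux (a : ℝ) (s : Multiset ℝ) (k : ℕ) :
    (a ::ₘ s).esymm (k + 1) = s.esymm (k + 1) + a * s.esymm k := by
  simp [Multiset.esymm, Multiset.powersetCard_cons, Multiset.map_map, Function.comp_def,
    Multiset.sum_map_mul_left]

theorem G_insert_aux (f : ℕ → ℝ) (T : Finset ℕ) (a : ℕ) (ha : a ∉ T) (p k : ℕ) :
    ∑ I ∈ (insert a T).powersetCard (p + 1), (I.val.map f).esymm (k + 1)
      = ∑ I ∈ T.powersetCard (p + 1), (I.val.map f).esymm (k + 1)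
        + ∑ J ∈ T.powersetCard p, (J.val.map f).esymm (k + 1)
        + f a * ∑ J ∈ T.powersetCard p, (J.val.map f).esymm k := by
  have hn : ∀ J ∈ T.powersetCard p, a ∉ J := fun J hJ h =>
    ha ((Finset.mem_powersetCard.1 hJ).1 h)
  rw [Finset.powersetCard_succ_insert ha, Finset.sum_union, Finset.sum_image, add_assoc]
  · congr 1
    rw [Finset.mul_sum, ← Finset.sum_add_distrib]
    refine Finset.sum_congr rfl fun J hJ => ?_
    rw [Finset.insert_val_of_notMem (hn J hJ), Multiset.map_cons, esymm_cons_aux]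
  · intro x hx y hy h
    have := congrArg (fun z => Finset.erase z a) h
    simpa [Finset.erase_insert (hn x hx), Finset.erase_insert (hn y hy)] using this
  · rw [Finset.disjoint_left]
    intro x hx hx'
    obtain ⟨J, hJ, rfl⟩ := Finset.mem_image.1 hx'
    exact ha ((Finset.mem_powersetCard.1 hx).1 (Finset.mem_insert_self _ _))

/-- **Proposition 3.**  With `S = S_n ⊂ … ⊂ S_0 = ℕ` the canonical path, `Ap i = S_i^(m)`
and `T_i = S_i^(m) \ {c_i + m}`, for any `f : ℕ → ℝ`, `1 ≤ p ≤ m` and `1 ≤ k ≤ p`: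
`∑_{i=1}^n (f(c_i+m) − f(c_i)) ∑_{J ⊆ T_i, |J|=p-1} e_{k-1}(f{J})
 = ∑_{I ⊆ S^(m), |I|=p} e_k(f{I}) − ∑_{I ⊆ I_m, |I|=p} e_k(f{I})`,
where `e_k` of a multiset of reals is the elementary symmetric function
(`Multiset.esymm`). -/
theorem prop3_elementary_symmetric
    (n : ℕ) (hn : 0 < n)
    (c : ℕ → ℕ) (hc : StrictMonoOn c (Set.Icc 1 n))
    (hzero : (0 : ℕ) ∈ SetSi c n)
    (hadd : ∀ a ∈ SetSi c n, ∀ b ∈ SetSi c n, a + b ∈ SetSi c n)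
    (m : ℕ) (hm0 : m ≠ 0) (hm : m ∈ SetSi c n)
    (Ap : ℕ → Finset ℕ) (hAp : ∀ i ≤ n, IsApery (SetSi c i) m (Ap i))
    (f : ℕ → ℝ)
    (p : ℕ) (hp : 1 ≤ p) (hpm : p ≤ m)
    (k : ℕ) (hk : 1 ≤ k) (hkp : k ≤ p) :
    ∑ i ∈ Finset.Icc 1 n,
        (f (c i + m) - f (c i)) *
          ∑ J ∈ ((Ap i).erase (c i + m)).powersetCard (p - 1),
            (J.val.map f).esymm (k - 1)
      = ∑ I ∈ (Ap n).powersetCard p, (I.val.map f).esymm k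
        - ∑ I ∈ (Finset.range m).powersetCard p, (I.val.map f).esymm k := by
  obtain ⟨p, rfl⟩ : ∃ q, p = q + 1 := ⟨p - 1, by omega⟩
  obtain ⟨k, rfl⟩ : ∃ q, k = q + 1 := ⟨k - 1, by omega⟩
  simp only [Nat.add_sub_cancel]
  have h0 : Ap 0 = Finset.range m := by
    ext s
    rw [hAp 0 (Nat.zero_le _) s, Finset.mem_range]
    constructor
    · rintro ⟨_, h⟩
      by_contra hs
      exact h (s - m) (by simp [SetSi]) (by omega)
    · intro hs
      exact ⟨by simp [SetSi], fun t _ => by omega⟩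
  have key : ∀ N ≤ n, ∑ i ∈ Finset.Icc 1 N,
        (f (c i + m) - f (c i)) *
          ∑ J ∈ ((Ap i).erase (c i + m)).powersetCard p, (J.val.map f).esymm k
      = ∑ I ∈ (Ap N).powersetCard (p + 1), (I.val.map f).esymm (k + 1)
        - ∑ I ∈ (Finset.range m).powersetCard (p + 1), (I.val.map f).esymm (k + 1) := by
    intro N
    induction N with
    | zero => intro _; simp [h0]
    | succ N ih =>
      intro hN
      rw [Finset.sum_Icc_succ_top (by omega), ih (by omega)]
      have hlt : ∀ j, 1 ≤ j → j ≤ N → c j < c (N + 1) := fun j h1 h2 =>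
        hc ⟨h1, by omega⟩ ⟨by omega, hN⟩ (by omega)
      have hge : ∀ j, N + 1 ≤ j → j ≤ n → c (N + 1) ≤ c j := fun j h1 h2 =>
        hc.monotoneOn ⟨by omega, hN⟩ ⟨by omega, h2⟩ h1
      have hsucc : ∀ s, s ∈ SetSi c (N + 1) ↔ s ∈ SetSi c N ∧ s ≠ c (N + 1) := by
        intro s
        simp only [SetSi, Set.mem_setOf_eq, Finset.mem_Icc]
        constructor
        · intro h
          exact ⟨fun j hj => h j ⟨hj.1, by omega⟩, h _ ⟨by omega, le_rfl⟩⟩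
        · rintro ⟨h, h'⟩ j hj
          rcases Nat.lt_or_ge N j with h1 | h1
          · obtain rfl : j = N + 1 := by omega
            exact h'
          · exact h j ⟨hj.1, h1⟩
      have hcm : c (N + 1) ∈ SetSi c N := by
        intro j hj
        rw [Finset.mem_Icc] at hj
        have := hlt j hj.1 hj.2
        omega
      have hcm' : c (N + 1) + m ∈ SetSi c (N + 1) := by
        rw [hsucc]
        refine ⟨?_, by omega⟩
        intro j hj
        rw [Finset.mem_Icc] at hj
        have := hlt j hj.1 hj.2
        omega
      have hA : c (N + 1) ∈ Ap N := by
        rw [hAp N (by omega)]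
        refine ⟨hcm, fun t ht he => ?_⟩
        have htn : t ∈ SetSi c n := by
          intro j hj
          rw [Finset.mem_Icc] at hj
          rcases Nat.lt_or_ge N j with h1 | h1
          · have := hge j h1 hj.2
            omega
          · exact ht j (Finset.mem_Icc.2 ⟨hj.1, h1⟩)
        exact hadd t htn m hm (N + 1) (Finset.mem_Icc.2 ⟨by omega, hN⟩) he
      have hB : c (N + 1) + m ∈ Ap (N + 1) := by
        rw [hAp (N + 1) hN]
        refine ⟨hcm', fun t ht he => ?_⟩
        exact ((hsucc t).1 ht).2 (by omega)
      have hT : (Ap (N + 1)).erase (c (N + 1) + m) = (Ap N).erase (c (N + 1)) := by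
        ext s
        rw [Finset.mem_erase, Finset.mem_erase, hAp (N + 1) hN, hAp N (by omega), hsucc]
        constructor
        · rintro ⟨h1, ⟨h2, h3⟩, h4⟩
          refine ⟨h3, h2, fun t ht he => ?_⟩
          by_cases htc : t = c (N + 1)
          · subst htc
            exact h1 he.symm
          · exact h4 t ((hsucc t).2 ⟨ht, htc⟩) he
        · rintro ⟨h1, h2, h3⟩
          exact ⟨fun he => h3 _ hcm he.symm, ⟨h2, h1⟩, fun t ht he => h3 t ((hsucc t).1 ht).1 he⟩
      have e1 := G_insert_aux f _ _ (Finset.notMem_erase (c (N + 1) + m) (Ap (N + 1))) p k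
      have e2 := G_insert_aux f _ _ (Finset.notMem_erase (c (N + 1)) (Ap N)) p k
      rw [Finset.insert_erase hB, hT] at e1
      rw [Finset.insert_erase hA] at e2
      rw [hT, e1, e2]
      ring
  exact key n le_rfl
end

section
/- (Proposition 4) For any f : ℤ≥0 → ℝ, any 1 ≤ p ≤ m, and any integer k ≥ 1: ∑_{i=1}^n (f(c_i + m) − f(c_i)) · ( ∑_{J ⊆ T_i, |J| = p−1} h_{k−1}(f{J}, f(c_i), f(c_i + m)) ) = ∑_{I ⊆ S^(m), |I| = p} h_k(f{I}) − ∑_{I ⊆ I_m, |I| = p} h_k(f{I}), where h_k denotes the complete homogeneous symmetric polynomial of degree k of its arguments (and h_0 = 1). -/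
open Finset

/-- The complete homogeneous symmetric function `h_k` evaluated at the elements of a
multiset `s` of reals: the coefficient of `X^k` in `∏_{x ∈ s} (1 - x X)⁻¹
= ∏_{x ∈ s} (∑_n x^n X^n)`.  In particular `h_0 = 1`. -/
noncomputable def Multiset.hsymm (s : Multiset ℝ) (k : ℕ) : ℝ :=
  PowerSeries.coeff k (s.map fun x => PowerSeries.mk fun n => x ^ n).prod

lemma mk_geom (x : ℝ) : (PowerSeries.mk fun n => x ^ n) =
    1 + PowerSeries.C x * PowerSeries.X * (PowerSeries.mk fun n => x ^ n) := by
  ext k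
  rcases k with _ | k
  · simp
  · rw [map_add, mul_assoc, PowerSeries.coeff_C_mul, PowerSeries.coeff_succ_X_mul]
    simp [PowerSeries.coeff_one, pow_succ']

lemma hsymm_diff (x y : ℝ) (s : Multiset ℝ) (k : ℕ) (hk : 1 ≤ k) :
    (y ::ₘ s).hsymm k - (x ::ₘ s).hsymm k = (y - x) * (x ::ₘ y ::ₘ s).hsymm (k - 1) := by
  obtain ⟨k, rfl⟩ : ∃ j, k = j + 1 := ⟨k - 1, by omega⟩
  have key : ∀ A B P : PowerSeries ℝ, A = 1 + PowerSeries.C x * PowerSeries.X * A →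
      B = 1 + PowerSeries.C y * PowerSeries.X * B →
      B * P - A * P = PowerSeries.C (y - x) * (PowerSeries.X * (A * (B * P))) := by
    intro A B P hA hB
    rw [map_sub]
    linear_combination (P * A) * hB - (P * B) * hA
  simp only [Multiset.hsymm, Multiset.map_cons, Multiset.prod_cons, Nat.add_sub_cancel]
  rw [← map_sub, key _ _ _ (mk_geom x) (mk_geom y), PowerSeries.coeff_C_mul,
    PowerSeries.coeff_succ_X_mul]

lemma sum_insert_pc (f : ℕ → ℝ) (T : Finset ℕ) (y : ℕ) (hy : y ∉ T) (p k : ℕ) :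
    ∑ I ∈ (insert y T).powersetCard (p + 1), (I.val.map f).hsymm k =
      ∑ I ∈ T.powersetCard (p + 1), (I.val.map f).hsymm k +
      ∑ J ∈ T.powersetCard p, (f y ::ₘ J.val.map f).hsymm k := by
  have hJ : ∀ J ∈ T.powersetCard p, y ∉ J := fun J h hyJ =>
    hy ((Finset.mem_powersetCard.1 h).1 hyJ)
  rw [Finset.powersetCard_succ_insert hy, Finset.sum_union, Finset.sum_image]
  · congr 1
    refine Finset.sum_congr rfl fun J h => ?_
    rw [Finset.insert_val_of_notMem (hJ J h), Multiset.map_cons]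
  · intro A hA B hB h
    rw [← Finset.erase_insert (hJ A hA), ← Finset.erase_insert (hJ B hB)]
    exact congrArg (fun z => z.erase y) h
  · rw [Finset.disjoint_left]
    intro I hI hI'
    obtain ⟨J, _, rfl⟩ := Finset.mem_image.1 hI'
    exact hy ((Finset.mem_powersetCard.1 hI).1 (Finset.mem_insert_self _ _))

/-- **Proposition 4.**  With `S = S_n ⊂ … ⊂ S_0 = ℕ` the canonical path, `Ap i = S_i^(m)`
and `T_i = S_i^(m) \ {c_i + m}`, for any `f : ℕ → ℝ`, `1 ≤ p ≤ m` and `k ≥ 1`: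
`∑_{i=1}^n (f(c_i+m) − f(c_i)) ∑_{J ⊆ T_i, |J|=p-1} h_{k-1}(f{J}, f(c_i), f(c_i+m))
 = ∑_{I ⊆ S^(m), |I|=p} h_k(f{I}) − ∑_{I ⊆ I_m, |I|=p} h_k(f{I})`. -/
theorem prop4_complete_homogeneous
    (n : ℕ) (hn : 0 < n)
    (c : ℕ → ℕ) (hc : StrictMonoOn c (Set.Icc 1 n))
    (hzero : (0 : ℕ) ∈ SetSi c n)
    (hadd : ∀ a ∈ SetSi c n, ∀ b ∈ SetSi c n, a + b ∈ SetSi c n)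
    (m : ℕ) (hm0 : m ≠ 0) (hm : m ∈ SetSi c n)
    (Ap : ℕ → Finset ℕ) (hAp : ∀ i ≤ n, IsApery (SetSi c i) m (Ap i))
    (f : ℕ → ℝ)
    (p : ℕ) (hp : 1 ≤ p) (hpm : p ≤ m)
    (k : ℕ) (hk : 1 ≤ k) :
    ∑ i ∈ Finset.Icc 1 n,
        (f (c i + m) - f (c i)) *
          ∑ J ∈ ((Ap i).erase (c i + m)).powersetCard (p - 1),
            (f (c i) ::ₘ f (c i + m) ::ₘ J.val.map f).hsymm (k - 1)
      = ∑ I ∈ (Ap n).powersetCard p, (I.val.map f).hsymm k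
        - ∑ I ∈ (Finset.range m).powersetCard p, (I.val.map f).hsymm k := by
  obtain ⟨p, rfl⟩ : ∃ j, p = j + 1 := ⟨p - 1, by omega⟩
  have h0 : Ap 0 = Finset.range m := by
    ext s
    rw [hAp 0 (Nat.zero_le _) s, Finset.mem_range]
    constructor
    · rintro ⟨_, h⟩
      by_contra hs
      exact h (s - m) (by simp [SetSi]) (by omega)
    · intro h
      exact ⟨by simp [SetSi], fun t _ => by omega⟩
  have hS : ∀ i s, s ∈ SetSi c (i + 1) ↔ s ∈ SetSi c i ∧ s ≠ c (i + 1) := by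
    intro i s
    simp only [SetSi, Set.mem_ofPred_eq, Finset.mem_Icc]
    constructor
    · intro h
      exact ⟨fun j hj => h j (by omega), h _ (by omega)⟩
    · rintro ⟨h, h'⟩ j hj
      rcases eq_or_ne j (i + 1) with rfl | hne
      · exact h'
      · exact h j (by omega)
  have step : ∀ i, i + 1 ≤ n →
      (Ap i).erase (c (i + 1)) = (Ap (i + 1)).erase (c (i + 1) + m) ∧
      c (i + 1) ∈ Ap i ∧ c (i + 1) + m ∈ Ap (i + 1) := by
    intro i hi
    have hlt : ∀ j, 1 ≤ j → j < i + 1 → c j < c (i + 1) := fun j h1 h2 =>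
      hc ⟨h1, by omega⟩ ⟨by omega, hi⟩ h2
    have hgt : ∀ j, i + 1 ≤ j → j ≤ n → c (i + 1) ≤ c j := fun j h1 h2 =>
      hc.monotoneOn ⟨by omega, hi⟩ ⟨by omega, h2⟩ h1
    have hcS : c (i + 1) ∈ SetSi c i := by
      intro j hj
      rw [Finset.mem_Icc] at hj
      exact (hlt j hj.1 (by omega)).ne'
    have hcmS : c (i + 1) + m ∈ SetSi c i := by
      intro j hj
      rw [Finset.mem_Icc] at hj
      have := hlt j hj.1 (by omega)
      omega
    have hct : ∀ t ∈ SetSi c i, t + m ≠ c (i + 1) := by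
      intro t ht h
      have htn : t ∈ SetSi c n := by
        intro j hj
        rw [Finset.mem_Icc] at hj
        rcases Nat.lt_or_ge i j with hij | hij
        · have := hgt j hij hj.2
          omega
        · exact ht j (Finset.mem_Icc.2 ⟨hj.1, hij⟩)
      exact hadd t htn m hm (i + 1) (Finset.mem_Icc.2 ⟨by omega, hi⟩) h
    refine ⟨?_, ?_, ?_⟩
    · ext s
      rw [Finset.mem_erase, Finset.mem_erase, hAp i (by omega) s, hAp (i + 1) hi s, hS]
      constructor
      · rintro ⟨h1, h2, h3⟩
        exact ⟨fun h => h3 _ hcS h.symm, ⟨h2, h1⟩, fun t ht => h3 t ((hS i t).1 ht).1⟩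
      · rintro ⟨h1, ⟨h2, h3⟩, h4⟩
        refine ⟨h3, h2, fun t ht h => ?_⟩
        rcases eq_or_ne t (c (i + 1)) with rfl | hne
        · exact h1 h.symm
        · exact h4 t ((hS i t).2 ⟨ht, hne⟩) h
    · exact (hAp i (by omega) _).2 ⟨hcS, hct⟩
    · refine (hAp (i + 1) hi _).2 ⟨(hS _ _).2 ⟨hcmS, by omega⟩, fun t ht h => ?_⟩
      exact ((hS i t).1 ht).2 (by omega)
  have main : ∀ N, N ≤ n →
      ∑ i ∈ Finset.Icc 1 N,
        (f (c i + m) - f (c i)) *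
          ∑ J ∈ ((Ap i).erase (c i + m)).powersetCard p,
            (f (c i) ::ₘ f (c i + m) ::ₘ J.val.map f).hsymm (k - 1)
      = ∑ I ∈ (Ap N).powersetCard (p + 1), (I.val.map f).hsymm k
        - ∑ I ∈ (Finset.range m).powersetCard (p + 1), (I.val.map f).hsymm k := by
    intro N
    induction N with
    | zero => intro _; simp [h0]
    | succ N ih =>
      intro hN
      obtain ⟨e, h1, h2⟩ := step N hN
      rw [Finset.sum_Icc_succ_top (by omega), ih (by omega)]
      have a1 := sum_insert_pc f ((Ap N).erase (c (N + 1))) (c (N + 1))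
        (Finset.notMem_erase _ _) p k
      have a2 := sum_insert_pc f ((Ap (N + 1)).erase (c (N + 1) + m)) (c (N + 1) + m)
        (Finset.notMem_erase _ _) p k
      rw [Finset.insert_erase h1, e] at a1
      rw [Finset.insert_erase h2] at a2
      have a3 := Finset.sum_congr (rfl : ((Ap (N + 1)).erase (c (N + 1) + m)).powersetCard p = _)
        fun J _ => (hsymm_diff (f (c (N + 1))) (f (c (N + 1) + m)) (J.val.map f) k hk).symm
      rw [a1, a2, Finset.mul_sum, a3, Finset.sum_sub_distrib]
      ring
  exact main n le_rfl
end

section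
/- (Proposition 5) Let f : ℤ≥0 → ℝ be injective on {0, 1, …, F(S) + m} and let w be a real polynomial. Then for any 1 ≤ p ≤ m: ∑_{i=1}^n (f(c_i + m) − f(c_i)) · ∑_{J ⊆ T_i, |J| = p−1} Δ(w; f{J}, f(c_i), f(c_i + m)) = ∑_{I ⊆ S^(m), |I| = p} Δ(w; f{I}) − ∑_{I ⊆ I_m, |I| = p} Δ(w; f{I}). -/
open Finset

/-- Newton divided difference of a polynomial `w` at a finite set `X` of (pairwise
distinct) nodes: `Δ(w; X) = ∑_{x ∈ X} w(x) / ∏_{y ∈ X, y ≠ x} (x − y)`. -/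
noncomputable def divDiff (w : Polynomial ℝ) (X : Finset ℝ) : ℝ :=
  ∑ x ∈ X, w.eval x / ∏ y ∈ X.erase x, (x - y)

lemma divDiff_insert (w : Polynomial ℝ) (X : Finset ℝ) (a : ℝ) (ha : a ∉ X) :
    divDiff w (insert a X) = w.eval a / ∏ y ∈ X, (a - y)
      + ∑ x ∈ X, w.eval x / ((x - a) * ∏ y ∈ X.erase x, (x - y)) := by
  unfold divDiff
  rw [Finset.sum_insert ha, Finset.erase_insert ha]
  congr 1
  refine Finset.sum_congr rfl fun x hx => ?_
  have hax : a ≠ x := fun h => ha (h ▸ hx)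
  rw [Finset.erase_insert_of_ne hax, Finset.prod_insert (fun h => ha (Finset.mem_of_mem_erase h))]

lemma divDiff_rec (w : Polynomial ℝ) (X : Finset ℝ) (a b : ℝ) (hab : a ≠ b)
    (ha : a ∉ X) (hb : b ∉ X) :
    (b - a) * divDiff w (insert a (insert b X))
      = divDiff w (insert b X) - divDiff w (insert a X) := by
  have hab' : a ∉ insert b X := by simp [hab, ha]
  rw [divDiff_insert w _ a hab', divDiff_insert w _ a ha, divDiff_insert w _ b hb,
    Finset.sum_insert hb, Finset.prod_insert hb, Finset.erase_insert hb]
  have h1 : a - b ≠ 0 := sub_ne_zero.2 hab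
  have h2 : b - a ≠ 0 := sub_ne_zero.2 hab.symm
  have pa : ∏ y ∈ X, (a - y) ≠ 0 :=
    Finset.prod_ne_zero_iff.2 fun y hy => sub_ne_zero.2 fun h => ha (h ▸ hy)
  have pb : ∏ y ∈ X, (b - y) ≠ 0 :=
    Finset.prod_ne_zero_iff.2 fun y hy => sub_ne_zero.2 fun h => hb (h ▸ hy)
  have key : (b - a) * ∑ x ∈ X, w.eval x / ((x - a) * ∏ y ∈ (insert b X).erase x, (x - y))
      = ∑ x ∈ X, w.eval x / ((x - b) * ∏ y ∈ X.erase x, (x - y))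
        - ∑ x ∈ X, w.eval x / ((x - a) * ∏ y ∈ X.erase x, (x - y)) := by
    rw [Finset.mul_sum, ← Finset.sum_sub_distrib]
    refine Finset.sum_congr rfl fun x hx => ?_
    have hbx : b ≠ x := fun h => hb (h ▸ hx)
    have hax : a ≠ x := fun h => ha (h ▸ hx)
    rw [Finset.erase_insert_of_ne hbx,
      Finset.prod_insert (fun h => hb (Finset.mem_of_mem_erase h))]
    have h3 : x - a ≠ 0 := sub_ne_zero.2 hax.symm
    have h4 : x - b ≠ 0 := sub_ne_zero.2 hbx.symm
    have px : ∏ y ∈ X.erase x, (x - y) ≠ 0 :=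
      Finset.prod_ne_zero_iff.2 fun y hy => sub_ne_zero.2 (Finset.ne_of_mem_erase hy).symm
    field_simp
    ring
  rw [mul_add, mul_add, key]
  have e1 : (b - a) * (w.eval a / ((a - b) * ∏ y ∈ X, (a - y)))
      = - (w.eval a / ∏ y ∈ X, (a - y)) := by
    field_simp
    ring
  have e2 : (b - a) * (w.eval b / ((b - a) * ∏ y ∈ X, (b - y)))
      = w.eval b / ∏ y ∈ X, (b - y) := by
    field_simp
  rw [e1, e2]
  ring

lemma sum_powersetCard_insert (g : Finset ℕ → ℝ) (T : Finset ℕ) (a : ℕ) (ha : a ∉ T) (q : ℕ) :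
    ∑ I ∈ (insert a T).powersetCard (q + 1), g I
      = ∑ I ∈ T.powersetCard (q + 1), g I + ∑ J ∈ T.powersetCard q, g (insert a J) := by
  rw [Finset.powersetCard_succ_insert ha, Finset.sum_union, Finset.sum_image]
  · intro x hx y hy h
    have hx' := (Finset.mem_powersetCard.1 hx).1
    have hy' := (Finset.mem_powersetCard.1 hy).1
    have := congrArg (fun s => s.erase a) h
    simpa [Finset.erase_insert (fun h => ha (hx' h)), Finset.erase_insert (fun h => ha (hy' h))]
      using this
  · rw [Finset.disjoint_left]
    intro x hx hx2
    obtain ⟨y, -, rfl⟩ := Finset.mem_image.1 hx2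
    exact ha ((Finset.mem_powersetCard.1 hx).1 (Finset.mem_insert_self _ _))



/-- **Proposition 5.**  With `S = S_n ⊂ … ⊂ S_0 = ℕ` the canonical path, `Ap i = S_i^(m)`
and `T_i = S_i^(m) \ {c_i + m}`, let `f : ℕ → ℝ` be injective on `{0, …, F(S) + m}`
(`F(S) = c n`) and `w` a real polynomial.  Then for `1 ≤ p ≤ m`:
`∑_{i=1}^n (f(c_i+m) − f(c_i)) ∑_{J ⊆ T_i, |J|=p-1} Δ(w; f{J}, f(c_i), f(c_i+m))
 = ∑_{I ⊆ S^(m), |I|=p} Δ(w; f{I}) − ∑_{I ⊆ I_m, |I|=p} Δ(w; f{I})`. -/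
theorem prop5_divided_differences
    (n : ℕ) (hn : 0 < n)
    (c : ℕ → ℕ) (hc : StrictMonoOn c (Set.Icc 1 n))
    (hzero : (0 : ℕ) ∈ SetSi c n)
    (hadd : ∀ a ∈ SetSi c n, ∀ b ∈ SetSi c n, a + b ∈ SetSi c n)
    (m : ℕ) (hm0 : m ≠ 0) (hm : m ∈ SetSi c n)
    (Ap : ℕ → Finset ℕ) (hAp : ∀ i ≤ n, IsApery (SetSi c i) m (Ap i))
    (f : ℕ → ℝ) (hf : ∀ j₁ ≤ c n + m, ∀ j₂ ≤ c n + m, f j₁ = f j₂ → j₁ = j₂)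
    (w : Polynomial ℝ)
    (p : ℕ) (hp : 1 ≤ p) (hpm : p ≤ m) :
    ∑ i ∈ Finset.Icc 1 n,
        (f (c i + m) - f (c i)) *
          ∑ J ∈ ((Ap i).erase (c i + m)).powersetCard (p - 1),
            divDiff w (insert (f (c i)) (insert (f (c i + m)) (J.image f)))
      = ∑ I ∈ (Ap n).powersetCard p, divDiff w (I.image f)
        - ∑ I ∈ (Finset.range m).powersetCard p, divDiff w (I.image f) := by
  obtain ⟨q, rfl⟩ : ∃ q, p = q + 1 := ⟨p - 1, by omega⟩
  rw [Nat.add_sub_cancel]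
  have hA0 : Ap 0 = Finset.range m := by
    ext s
    rw [hAp 0 (Nat.zero_le _) s]
    simp only [SetSi, Set.mem_setOf_eq, Finset.mem_range]
    constructor
    · rintro ⟨-, h⟩
      by_contra hs
      exact h (s - m) (by simp) (by omega)
    · intro hs
      exact ⟨by simp, fun t _ => by omega⟩
  -- membership in consecutive sets
  have hsucc : ∀ i s, s ∈ SetSi c (i + 1) ↔ s ∈ SetSi c i ∧ s ≠ c (i + 1) := by
    intro i s
    simp only [SetSi, Set.mem_setOf_eq, Finset.mem_Icc]
    constructor
    · intro h
      exact ⟨fun j hj => h j (by omega), h (i + 1) (by omega)⟩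
    · rintro ⟨h1, h2⟩ j hj
      rcases Nat.lt_or_ge j (i + 1) with h | h
      · exact h1 j (by omega)
      · obtain rfl : j = i + 1 := by omega
        exact h2
  have hlt : ∀ i j, 1 ≤ i → i < j → j ≤ n → c i < c j := fun i j h1 h2 h3 =>
    hc ⟨h1, by omega⟩ ⟨by omega, h3⟩ h2
  have hle : ∀ i, 1 ≤ i → i ≤ n → c i ≤ c n := by
    intro i h1 h2
    rcases h2.lt_or_eq with h | h
    · exact (hlt i n h1 h le_rfl).le
    · rw [h]
  have hbd : ∀ i ≤ n, ∀ s ∈ Ap i, s ≤ c n + m := by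
    intro i hi s hs
    have h := ((hAp i hi s).1 hs).2
    by_contra hcon
    refine h (s - m) ?_ (by omega)
    intro j hj
    rw [Finset.mem_Icc] at hj
    have := hle j hj.1 (by omega)
    omega
  have hself : ∀ i < n, c (i + 1) ∈ SetSi c i := by
    intro i hi j hj
    rw [Finset.mem_Icc] at hj
    have := hlt j (i + 1) hj.1 (by omega) (by omega)
    omega
  have hstep : ∀ i < n, ∃ T : Finset ℕ, c (i + 1) ∉ T ∧ c (i + 1) + m ∉ T ∧
      Ap i = insert (c (i + 1)) T ∧ Ap (i + 1) = insert (c (i + 1) + m) T := by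
    intro i hi
    have hmem : c (i + 1) + m ∈ Ap (i + 1) := by
      rw [hAp (i + 1) hi]
      refine ⟨?_, ?_⟩
      · intro j hj
        rw [Finset.mem_Icc] at hj
        rcases hj.2.lt_or_eq with h | h
        · have := hlt j (i + 1) hj.1 h hi
          omega
        · subst h
          omega
      · intro t ht h
        obtain rfl : t = c (i + 1) := by omega
        exact ((hsucc _ _).1 ht).2 rfl
    have hmem' : c (i + 1) ∈ Ap i := by
      rw [hAp i hi.le]
      refine ⟨hself i hi, ?_⟩
      intro t ht h
      have htn : t ∈ SetSi c n := by
        intro j hj hj'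
        rw [Finset.mem_Icc] at hj
        rcases Nat.lt_or_ge i j with h1 | h1
        · have : c (i + 1) ≤ c j := by
            rcases (Nat.succ_le_of_lt h1).lt_or_eq with h2 | h2
            · exact (hlt (i + 1) j (by omega) h2 hj.2).le
            · rw [← h2]
          omega
        · exact ht j (Finset.mem_Icc.2 ⟨hj.1, h1⟩) hj'
      exact hadd t htn m hm (i + 1) (Finset.mem_Icc.2 ⟨by omega, hi⟩) h
    have hnot : c (i + 1) ∉ Ap (i + 1) := fun h =>
      ((hsucc _ _).1 ((hAp (i + 1) hi _).1 h).1).2 rfl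
    have hnot' : c (i + 1) + m ∉ Ap i := fun h =>
      ((hAp i hi.le _).1 h).2 _ (hself i hi) rfl
    have hT : ∀ s, s ≠ c (i + 1) → s ≠ c (i + 1) + m → (s ∈ Ap i ↔ s ∈ Ap (i + 1)) := by
      intro s h1 h2
      rw [hAp i hi.le, hAp (i + 1) hi, hsucc]
      constructor
      · rintro ⟨h3, h4⟩
        exact ⟨⟨h3, h1⟩, fun t ht => h4 t ((hsucc _ _).1 ht).1⟩
      · rintro ⟨⟨h3, -⟩, h4⟩
        refine ⟨h3, fun t ht hts => ?_⟩
        refine h4 t ((hsucc _ _).2 ⟨ht, ?_⟩) hts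
        rintro rfl
        exact h2 hts.symm
    refine ⟨(Ap (i + 1)).erase (c (i + 1) + m), ?_, Finset.notMem_erase _ _, ?_,
      (Finset.insert_erase hmem).symm⟩
    · exact fun h => hnot (Finset.mem_of_mem_erase h)
    · ext s
      rw [Finset.mem_insert, Finset.mem_erase]
      by_cases h1 : s = c (i + 1)
      · subst h1
        simp [hmem']
      · by_cases h2 : s = c (i + 1) + m
        · subst h2
          simp [hnot', hm0]
        · simp [h1, h2, hT s h1 h2]
  have main : ∀ k ≤ n, ∑ i ∈ Finset.Icc 1 k,
        (f (c i + m) - f (c i)) *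
          ∑ J ∈ ((Ap i).erase (c i + m)).powersetCard q,
            divDiff w (insert (f (c i)) (insert (f (c i + m)) (J.image f)))
      = ∑ I ∈ (Ap k).powersetCard (q + 1), divDiff w (I.image f)
        - ∑ I ∈ (Finset.range m).powersetCard (q + 1), divDiff w (I.image f) := by
    intro k
    induction k with
    | zero => intro _; simp [hA0]
    | succ k ih =>
      intro hk
      rw [Finset.sum_Icc_succ_top (by omega), ih (by omega)]
      obtain ⟨T, hT1, hT2, hT3, hT4⟩ := hstep k hk
      have hTb : ∀ s ∈ T, s ≤ c n + m := fun s hs =>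
        hbd k (by omega) s (hT3 ▸ Finset.mem_insert_of_mem hs)
      have hck := hle (k + 1) (by omega) hk
      rw [hT4, Finset.erase_insert hT2, hT3, sum_powersetCard_insert _ _ _ hT1,
        sum_powersetCard_insert _ _ _ hT2]
      have e : (f (c (k + 1) + m) - f (c (k + 1))) * ∑ J ∈ T.powersetCard q,
            divDiff w (insert (f (c (k + 1))) (insert (f (c (k + 1) + m)) (J.image f)))
          = ∑ J ∈ T.powersetCard q, divDiff w ((insert (c (k + 1) + m) J).image f)
            - ∑ J ∈ T.powersetCard q, divDiff w ((insert (c (k + 1)) J).image f) := by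
        rw [Finset.mul_sum, ← Finset.sum_sub_distrib]
        refine Finset.sum_congr rfl fun J hJ => ?_
        have hJT := (Finset.mem_powersetCard.1 hJ).1
        rw [Finset.image_insert, Finset.image_insert]
        apply divDiff_rec
        · intro h
          have := hf _ (by omega) _ (by omega) h
          omega
        · intro h
          obtain ⟨s, hs, hs'⟩ := Finset.mem_image.1 h
          have := hf _ (hTb s (hJT hs)) _ (by omega) hs'
          exact hT1 (this ▸ hJT hs)
        · intro h
          obtain ⟨s, hs, hs'⟩ := Finset.mem_image.1 h
          have := hf _ (hTb s (hJT hs)) _ (by omega) hs'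
          exact hT2 (this ▸ hJT hs)
      rw [e]
      ring
  exact main n le_rfl
end

section
/- (Proposition 6) For integers k ≥ 1 and 1 ≤ p < m: ∏_{i=1}^n ∏_{J ⊆ T_i \ {0}, |J| = p−1} ( 1 + (∑_{j=1}^k C(k,j)·c_i^{k−j}·m^j) / (∑_{a ∈ J} a^k + c_i^k) ) = ( ∏_{I ⊆ S^(m) \ {0}, |I| = p} ∑_{a ∈ I} a^k ) / ( ∏_{I ⊆ I_m \ {0}, |I| = p} ∑_{a ∈ I} a^k ), where C(k,j) denotes the binomial coefficient; all quantities are rational numbers and all denominators are nonzero. -/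
open Finset

def PP (k p : ℕ) (A : Finset ℕ) : ℚ :=
  ∏ I ∈ (A.erase 0).powersetCard p, ∑ a ∈ I, (a : ℚ) ^ k

lemma PP_ne (k p : ℕ) (hp : 1 ≤ p) (A : Finset ℕ) : PP k p A ≠ 0 := by
  unfold PP
  rw [Finset.prod_ne_zero_iff]
  intro I hI
  rw [Finset.mem_powersetCard] at hI
  apply ne_of_gt
  apply Finset.sum_pos
  · intro a ha
    have h := hI.1 ha
    rw [Finset.mem_erase] at h
    have : (0 : ℚ) < a := by exact_mod_cast Nat.pos_of_ne_zero h.1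
    positivity
  · rw [← Finset.card_pos]; omega

lemma PP_insert (k p : ℕ) (hp : 1 ≤ p) (T : Finset ℕ) (x : ℕ) (hx0 : x ≠ 0) (hx : x ∉ T) :
    PP k p (insert x T) = PP k p T *
      ∏ J ∈ (T.erase 0).powersetCard (p - 1), (∑ a ∈ J, (a : ℚ) ^ k + (x : ℚ) ^ k) := by
  obtain ⟨q, rfl⟩ : ∃ q, p = q + 1 := ⟨p - 1, by omega⟩
  unfold PP
  have hx' : x ∉ T.erase 0 := fun h => hx (Finset.mem_of_mem_erase h)
  rw [Finset.erase_insert_of_ne hx0, Finset.powersetCard_succ_insert hx',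
    Finset.prod_union, Finset.prod_image]
  · simp only [Nat.add_sub_cancel]
    congr 1
    apply Finset.prod_congr rfl
    intro J hJ
    rw [Finset.mem_powersetCard] at hJ
    rw [Finset.sum_insert (fun h => hx' (hJ.1 h)), add_comm]
  · intro I hI J hJ h
    simp only [Finset.mem_coe, Finset.mem_powersetCard] at hI hJ
    have hI' : x ∉ I := fun h => hx' (hI.1 h)
    have hJ' : x ∉ J := fun h => hx' (hJ.1 h)
    rw [← Finset.erase_insert hI', ← Finset.erase_insert hJ']
    exact congrArg (fun s => s.erase x) h
  · rw [Finset.disjoint_left]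
    intro I hI hI2
    rw [Finset.mem_image] at hI2
    obtain ⟨J, _, rfl⟩ := hI2
    rw [Finset.mem_powersetCard] at hI
    exact hx' (hI.1 (Finset.mem_insert_self _ _))

lemma binom_aux (k c m : ℕ) :
    (c : ℚ) ^ k + ∑ j ∈ Finset.Icc 1 k, (k.choose j : ℚ) * (c : ℚ) ^ (k - j) * (m : ℚ) ^ j
      = ((c + m : ℕ) : ℚ) ^ k := by
  push_cast
  rw [add_comm (c : ℚ) m, add_pow, Finset.range_eq_Ico, Finset.sum_eq_sum_Ico_succ_bot (by omega)]
  congr 1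
  · simp
  · apply Finset.sum_congr
    · rfl
    · intros; ring

lemma step_aux (k p c m : ℕ) (hp : 1 ≤ p) (T : Finset ℕ) (hc : c ≠ 0)
    (h1 : c ∉ T) (h2 : c + m ∉ T) :
    PP k p (insert c T) * ∏ J ∈ (T.erase 0).powersetCard (p - 1),
          (1 + (∑ j ∈ Finset.Icc 1 k,
                  (k.choose j : ℚ) * (c : ℚ) ^ (k - j) * (m : ℚ) ^ j)
               / (∑ a ∈ J, (a : ℚ) ^ k + (c : ℚ) ^ k)) = PP k p (insert (c + m) T) := by
  rw [PP_insert k p hp T c hc h1, PP_insert k p hp T (c + m) (by omega) h2, mul_assoc,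
    ← Finset.prod_mul_distrib]
  congr 1
  apply Finset.prod_congr rfl
  intro J _
  have : (0 : ℚ) < c := by exact_mod_cast Nat.pos_of_ne_zero hc
  have h : ∑ a ∈ J, (a : ℚ) ^ k + (c : ℚ) ^ k ≠ 0 := by positivity
  rw [← binom_aux, mul_add, mul_div_cancel₀ _ h]
  ring

/-- **Proposition 6.**  With `S = S_n ⊂ … ⊂ S_0 = ℕ` the canonical path, `Ap i = S_i^(m)`
and `T_i = S_i^(m) \ {c_i + m}`, for integers `k ≥ 1` and `1 ≤ p < m`:
`∏_{i=1}^n ∏_{J ⊆ T_i \ {0}, |J|=p-1} (1 + (∑_{j=1}^k C(k,j) c_i^{k−j} m^j)/(∑_{a ∈ J} a^k + c_i^k))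
 = (∏_{I ⊆ S^(m) \ {0}, |I|=p} ∑_{a ∈ I} a^k) / (∏_{I ⊆ I_m \ {0}, |I|=p} ∑_{a ∈ I} a^k)`
as rational numbers. -/
theorem prop6_multiplicative
    (n : ℕ) (hn : 0 < n)
    (c : ℕ → ℕ) (hc : StrictMonoOn c (Set.Icc 1 n))
    (hzero : (0 : ℕ) ∈ SetSi c n)
    (hadd : ∀ a ∈ SetSi c n, ∀ b ∈ SetSi c n, a + b ∈ SetSi c n)
    (m : ℕ) (hm0 : m ≠ 0) (hm : m ∈ SetSi c n)
    (Ap : ℕ → Finset ℕ) (hAp : ∀ i ≤ n, IsApery (SetSi c i) m (Ap i))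
    (k : ℕ) (hk : 1 ≤ k)
    (p : ℕ) (hp : 1 ≤ p) (hpm : p < m) :
    ∏ i ∈ Finset.Icc 1 n,
        ∏ J ∈ (((Ap i).erase (c i + m)).erase 0).powersetCard (p - 1),
          (1 + (∑ j ∈ Finset.Icc 1 k,
                  (k.choose j : ℚ) * (c i : ℚ) ^ (k - j) * (m : ℚ) ^ j)
               / (∑ a ∈ J, (a : ℚ) ^ k + (c i : ℚ) ^ k))
      = (∏ I ∈ ((Ap n).erase 0).powersetCard p, ∑ a ∈ I, (a : ℚ) ^ k)
        / (∏ I ∈ ((Finset.range m).erase 0).powersetCard p, ∑ a ∈ I, (a : ℚ) ^ k) := by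
  have hc0 : ∀ i, 1 ≤ i → i ≤ n → c i ≠ 0 := fun i h1 h2 h =>
    hzero i (Finset.mem_Icc.2 ⟨h1, h2⟩) h.symm
  have key : ∀ i ≤ n, ∏ i ∈ Finset.Icc 1 i,
        ∏ J ∈ (((Ap i).erase (c i + m)).erase 0).powersetCard (p - 1),
          (1 + (∑ j ∈ Finset.Icc 1 k,
                  (k.choose j : ℚ) * (c i : ℚ) ^ (k - j) * (m : ℚ) ^ j)
               / (∑ a ∈ J, (a : ℚ) ^ k + (c i : ℚ) ^ k))
      = PP k p (Ap i) / PP k p (Finset.range m) := by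
    intro i
    induction i with
    | zero =>
      intro _
      have : Ap 0 = Finset.range m := by
        ext s
        rw [hAp 0 (by omega) s, Finset.mem_range]
        simp only [SetSi, Set.mem_setOf_eq]
        constructor
        · rintro ⟨_, h⟩
          by_contra hs
          exact h (s - m) (by simp) (by omega)
        · intro h
          exact ⟨by simp, fun t _ => by omega⟩
      rw [this, div_self (PP_ne k p hp _)]
      simp
    | succ i ih =>
      intro hi
      have hI := hAp i (by omega)
      have hJ := hAp (i + 1) hi
      have hlt : ∀ j ∈ Finset.Icc 1 i, c j < c (i + 1) := by
        intro j hj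
        rw [Finset.mem_Icc] at hj
        exact hc ⟨by omega, by omega⟩ ⟨by omega, by omega⟩ (by omega)
      have hmem : ∀ s, s ∈ SetSi c (i + 1) ↔ s ∈ SetSi c i ∧ s ≠ c (i + 1) := by
        intro s
        simp only [SetSi, Set.mem_setOf_eq, Finset.mem_Icc]
        constructor
        · intro h
          exact ⟨fun j hj => h j (by omega), h _ (by omega)⟩
        · rintro ⟨h, h'⟩ j hj
          rcases Nat.lt_or_ge i j with h3 | h3
          · obtain rfl : j = i + 1 := by omega
            exact h'
          · exact h j (by omega)
      have hge : ∀ s, c (i + 1) ≤ s → s ∈ SetSi c i := by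
        intro s hs j hj
        have := hlt j hj
        omega
      have hno : ∀ t ∈ SetSi c i, t + m ≠ c (i + 1) := by
        intro t ht h
        have htn : t ∈ SetSi c n := by
          intro j hj
          rw [Finset.mem_Icc] at hj
          rcases Nat.lt_or_ge i j with h3 | h3
          · have : c (i + 1) ≤ c j :=
              hc.monotoneOn ⟨by omega, by omega⟩ ⟨by omega, by omega⟩ (by omega)
            omega
          · exact ht j (Finset.mem_Icc.2 (by omega))
        exact hadd t htn m hm (i + 1) (Finset.mem_Icc.2 (by omega)) h
      set T := (Ap (i + 1)).erase (c (i + 1) + m) with hT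
      have e1 : insert (c (i + 1) + m) T = Ap (i + 1) := by
        apply Finset.insert_erase
        rw [hJ]
        refine ⟨(hmem _).2 ⟨hge _ (by omega), by omega⟩, fun t ht h => ?_⟩
        exact ((hmem t).1 ht).2 (by omega)
      have h1 : c (i + 1) ∉ T := by
        intro h
        have h := (hJ _).1 (Finset.mem_of_mem_erase h)
        exact ((hmem _).1 h.1).2 rfl
      have e2 : insert (c (i + 1)) T = Ap i := by
        ext s
        rw [Finset.mem_insert, hT, Finset.mem_erase, hJ, hI, hmem]
        constructor
        · rintro (rfl | ⟨h2, ⟨h3, h4⟩, h5⟩)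
          · exact ⟨hge _ le_rfl, hno⟩
          · refine ⟨h3, fun t ht h => ?_⟩
            by_cases htc : t = c (i + 1)
            · subst htc; exact h2 h.symm
            · exact h5 t ((hmem t).2 ⟨ht, htc⟩) h
        · rintro ⟨h2, h3⟩
          by_cases hs : s = c (i + 1)
          · exact Or.inl hs
          · exact Or.inr ⟨fun h => h3 _ (hge _ le_rfl) h.symm, ⟨h2, hs⟩,
              fun t ht => h3 t ((hmem t).1 ht).1⟩
      rw [Finset.prod_Icc_succ_top (by omega), ih (by omega), ← hT, div_mul_eq_mul_div, ← e2,
        step_aux k p _ m hp T (hc0 _ (by omega) hi) h1 (Finset.notMem_erase _ _), e1]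
  exact key n le_rfl
end

section
/- (Proposition 6, case p = 1, k = 1) ∏_{i=1}^n (1 + m/c_i) = ( ∏_{a ∈ S^(m), a ≠ 0} a ) / (m−1)!, as an identity of rational numbers. -/
open Finset

theorem aux_prod_Icc (n : ℕ) : ∏ x ∈ Finset.Icc 1 n, x = n.factorial := by
  induction n with
  | zero => simp
  | succ k ih =>
    rw [Finset.prod_Icc_succ_top (by omega), ih, Nat.factorial_succ, mul_comm]

/-- **Proposition 6, case `p = 1`, `k = 1`.**  Let `S` be a numerical semigroup with gap
set `C = {c_1 < … < c_n}`, `m ∈ S`, `m ≠ 0`, and Apéry set `S^(m)`.  Then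
`∏_{i=1}^n (1 + m/c_i) = (∏_{a ∈ S^(m), a ≠ 0} a) / (m−1)!` as rational numbers. -/
theorem prop6_case_p_one_k_one
    (S : Set ℕ) (h0 : 0 ∈ S) (hadd : ∀ a ∈ S, ∀ b ∈ S, a + b ∈ S)
    (C : Finset ℕ) (hC : ∀ k, k ∈ C ↔ k ∉ S) (hCne : C.Nonempty)
    (m : ℕ) (hm0 : m ≠ 0) (hm : m ∈ S)
    (Ap : Finset ℕ) (hAp : IsApery S m Ap) :
    ∏ i ∈ C, (1 + (m : ℚ) / (i : ℚ))
      = (∏ a ∈ Ap.erase 0, (a : ℚ)) / ((m - 1).factorial : ℚ) := by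
  have hC0 : ∀ c ∈ C, c ≠ 0 := by
    rintro c hc rfl
    exact (hC 0).1 hc h0
  have hd1 : Disjoint C (Ap.erase 0) := by
    rw [Finset.disjoint_left]
    intro x hx hx'
    exact (hC x).1 hx ((hAp x).1 (Finset.mem_of_mem_erase hx')).1
  have hd2 : Disjoint (Finset.Icc 1 (m - 1)) (C.image (fun c => c + m)) := by
    rw [Finset.disjoint_left]
    intro x hx hx'
    rw [Finset.mem_Icc] at hx
    obtain ⟨c, _, hc⟩ := Finset.mem_image.1 hx'
    omega
  have hU : C ∪ Ap.erase 0 = Finset.Icc 1 (m - 1) ∪ C.image (fun c => c + m) := by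
    ext x
    simp only [Finset.mem_union, Finset.mem_erase, Finset.mem_Icc, Finset.mem_image]
    constructor
    · intro h
      have hx0 : x ≠ 0 := by
        rcases h with h | h
        · exact hC0 x h
        · exact h.1
      by_cases hxm : x < m
      · left; omega
      · right
        refine ⟨x - m, ?_, by omega⟩
        rw [hC]
        intro hS
        rcases h with h | h
        · apply (hC x).1 h
          have := hadd _ hS _ hm
          rwa [Nat.sub_add_cancel (by omega)] at this
        · exact ((hAp x).1 h.2).2 _ hS (by omega)
    · intro h
      by_cases hxS : x ∈ S
      · right
        rcases h with h | ⟨c, hc, rfl⟩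
        · exact ⟨by omega, (hAp x).2 ⟨hxS, fun t _ => by omega⟩⟩
        · refine ⟨by omega, (hAp _).2 ⟨hxS, fun t ht hh => ?_⟩⟩
          have : t = c := by omega
          exact (hC c).1 hc (this ▸ ht)
      · left; exact (hC x).2 hxS
  have key : (∏ c ∈ C, (c : ℚ)) * ∏ a ∈ Ap.erase 0, (a : ℚ)
      = ((m - 1).factorial : ℚ) * ∏ c ∈ C, ((c : ℚ) + m) := by
    rw [← Finset.prod_union hd1, hU, Finset.prod_union hd2,
      Finset.prod_image (fun a _ b _ h => Nat.add_right_cancel h),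
      ← aux_prod_Icc]
    push_cast
    rfl
  have hne : (∏ c ∈ C, (c : ℚ)) ≠ 0 :=
    Finset.prod_ne_zero_iff.2 fun c hc => Nat.cast_ne_zero.2 (hC0 c hc)
  have hf : ((m - 1).factorial : ℚ) ≠ 0 := Nat.cast_ne_zero.2 (Nat.factorial_ne_zero _)
  have hL : ∏ i ∈ C, (1 + (m : ℚ) / (i : ℚ)) = (∏ c ∈ C, ((c : ℚ) + m)) / ∏ c ∈ C, (c : ℚ) := by
    rw [← Finset.prod_div_distrib]
    refine Finset.prod_congr rfl fun c hc => ?_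
    have : (c : ℚ) ≠ 0 := Nat.cast_ne_zero.2 (hC0 c hc)
    field_simp
  rw [hL, div_eq_div_iff hne hf]
  linarith
end
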